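/- arXiv:1407.8297 — 5 statements merged into one kernel-verified Lean document; each statement's English description precedes it below -/
import Mathlib

section
/- Let m ∈ ℕ and let μ = (μ₁,μ₂) ∈ ℤ² satisfy μ₂ < 0 and μ₁ < m²·μ₂. Then for all standard sets Δ, Δ' ⊆ ℕ² of cardinality m: ⟨μ,Δ⟩ ≥ ⟨μ,Δ'⟩ if and only if either ∑_{(a,b)∈Δ} a < ∑_{(a,b)∈Δ'} a, or ( ∑_{(a,b)∈Δ} a = ∑_{(a,b)∈Δ'} a and ∑_{(a,b)∈Δ} b ≤ ∑_{(a,b)∈Δ'} b ). In other words, the preorder ≤_μ is the lexicographic refinement of ≤_{(−1,0)} by ≤_{(0,−1)}. -/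
/-- A standard set (staircase) in `ℕ²`: a finite, downward closed set. -/
def IsStandardSet (Δ : Finset (ℕ × ℕ)) : Prop :=
  ∀ p ∈ Δ, ∀ q : ℕ × ℕ, q.1 ≤ p.1 → q.2 ≤ p.2 → q ∈ Δ

/-- The weight of a finite subset of `ℕ²` with respect to a weight vector `ξ ∈ ℤ²`. -/
def setWeight (ξ : ℤ × ℤ) (Δ : Finset (ℕ × ℕ)) : ℤ :=
  ∑ p ∈ Δ, (ξ.1 * (p.1 : ℤ) + ξ.2 * (p.2 : ℤ))

theorem sum_snd_le_aux (Δ : Finset (ℕ × ℕ)) (h : IsStandardSet Δ) :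
    ∑ p ∈ Δ, p.2 ≤ Δ.card ^ 2 := by
  have hb : ∀ p ∈ Δ, p.2 ≤ Δ.card := by
    intro p hp
    have hs : (Finset.range p.2).image (fun j => (p.1, j)) ⊆ Δ := by
      intro q hq
      simp only [Finset.mem_image, Finset.mem_range] at hq
      obtain ⟨j, hj, rfl⟩ := hq
      exact h p hp _ le_rfl hj.le
    have hc := Finset.card_le_card hs
    rw [Finset.card_image_of_injective _ (fun a b hab => by simpa using hab),
      Finset.card_range] at hc
    exact hc
  have := Finset.sum_le_card_nsmul Δ (fun p => p.2) _ hb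
  rw [smul_eq_mul] at this
  rw [sq]
  exact this

theorem setWeight_eq_aux (ξ : ℤ × ℤ) (Δ : Finset (ℕ × ℕ)) :
    setWeight ξ Δ = ξ.1 * ((∑ p ∈ Δ, p.1 : ℕ) : ℤ) + ξ.2 * ((∑ p ∈ Δ, p.2 : ℕ) : ℤ) := by
  unfold setWeight
  push_cast
  rw [Finset.sum_add_distrib, Finset.mul_sum, Finset.mul_sum]

theorem lex_aux (M x y A B A' B' : ℤ) (hy : y < 0) (hx : x < M * y) (hM : 0 ≤ M)
    (hB : B ≤ M) (hB' : 0 ≤ B') (hA : A < A') : x * A' + y * B' < x * A + y * B := by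
  have hx0 : x < 0 := by nlinarith
  have h1 : x * (A' - A) ≤ x := by nlinarith
  have h2 : M * y ≤ y * (B - B') := by nlinarith
  nlinarith

/-- For `μ = (μ₁, μ₂)` with `μ₁ ≪ μ₂ < 0` (precisely `μ₁ < m²·μ₂`), the preorder `≤_μ`
on standard sets of cardinality `m` is the lexicographic refinement of `≤_{(-1,0)}`
by `≤_{(0,-1)}`. -/
theorem mu_ordering_is_lex (m : ℕ) (μ : ℤ × ℤ) (hμ2 : μ.2 < 0)
    (hμ1 : μ.1 < (m : ℤ)^2 * μ.2)
    (Δ Δ' : Finset (ℕ × ℕ)) (hΔ : IsStandardSet Δ) (hΔ' : IsStandardSet Δ')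
    (hcard : Δ.card = m) (hcard' : Δ'.card = m) :
    setWeight μ Δ' ≤ setWeight μ Δ ↔
      ((∑ p ∈ Δ, p.1) < (∑ p ∈ Δ', p.1) ∨
        ((∑ p ∈ Δ, p.1) = (∑ p ∈ Δ', p.1) ∧ (∑ p ∈ Δ, p.2) ≤ (∑ p ∈ Δ', p.2))) := by
  have hb := sum_snd_le_aux Δ hΔ
  have hb' := sum_snd_le_aux Δ' hΔ'
  rw [hcard] at hb
  rw [hcard'] at hb'
  rw [setWeight_eq_aux, setWeight_eq_aux]
  generalize (∑ p ∈ Δ, p.1) = A at *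
  generalize (∑ p ∈ Δ', p.1) = A' at *
  generalize (∑ p ∈ Δ, p.2) = B at *
  generalize (∑ p ∈ Δ', p.2) = B' at *
  have hbz : (B : ℤ) ≤ (m : ℤ) ^ 2 := by exact_mod_cast hb
  have hbz' : (B' : ℤ) ≤ (m : ℤ) ^ 2 := by exact_mod_cast hb'
  rcases lt_trichotomy A A' with hlt | heq | hgt
  · have := lex_aux _ _ _ A B A' B' hμ2 hμ1 (by positivity) hbz (by positivity)
      (by exact_mod_cast hlt)
    exact ⟨fun _ => Or.inl hlt, fun _ => this.le⟩
  · subst heq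
    simp only [lt_self_iff_false, false_or, true_and, add_le_add_iff_left]
    rw [mul_le_mul_left_of_neg hμ2]
    exact Nat.cast_le
  · have := lex_aux _ _ _ A' B' A B hμ2 hμ1 (by positivity) hbz' (by positivity)
      (by exact_mod_cast hgt)
    constructor
    · intro h
      exact absurd h (not_le.mpr this)
    · intro h
      omega
end

section
/- Let λ = (λ₁,λ₂) ∈ ℤ² with λ₁ < 0 < λ₂, and let Δ, Δ' be standard sets of the same cardinality m with Δ ≤ Δ' in the dominance order and Δ ≠ Δ'. Then ⟨λ,Δ⟩ > ⟨λ,Δ'⟩, i.e. Δ <_λ Δ'. Thus the ordering ≤_λ strictly refines the dominance order on standard sets of cardinality m. -/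
/-- The dominance (natural) partial order on standard sets of equal cardinality. -/
def DomLE (Δ Δ' : Finset (ℕ × ℕ)) : Prop :=
  (∀ i : ℕ, (Δ.filter (fun p => p.2 < i)).card ≤ (Δ'.filter (fun p => p.2 < i)).card) ∧
  (∀ j : ℕ, (Δ'.filter (fun p => p.1 < j)).card ≤ (Δ.filter (fun p => p.1 < j)).card)

lemma sum_add_counts (f : ℕ × ℕ → ℕ) (N : ℕ) (D : Finset (ℕ × ℕ)) (h : ∀ p ∈ D, f p ≤ N) :
    ∑ p ∈ D, f p + ∑ i ∈ Finset.range N, (D.filter (fun p => f p < i + 1)).card = D.card * N := by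
  simp only [Finset.card_filter]
  rw [Finset.sum_comm, ← Finset.sum_add_distrib, ← smul_eq_mul, ← Finset.sum_const]
  apply Finset.sum_congr rfl
  intro p hp
  have h1 := h p hp
  rw [← Finset.card_filter]
  have : (Finset.range N).filter (fun i => f p < i + 1) = Finset.Ico (f p) N := by
    ext i
    simp only [Finset.mem_filter, Finset.mem_range, Finset.mem_Ico]
    omega
  rw [this, Nat.card_Ico]
  omega

lemma row_split (D : Finset (ℕ × ℕ)) (b : ℕ) :
    (D.filter (fun p => p.2 < b + 1)).card =
      (D.filter (fun p => p.2 < b)).card + (D.filter (fun p => p.2 = b)).card := by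
  rw [← Finset.card_union_of_disjoint]
  · congr 1
    ext p
    simp only [Finset.mem_filter, Finset.mem_union, ← and_or_left, Nat.lt_succ_iff_lt_or_eq]
  · rw [Finset.disjoint_filter]
    intro p _ h1 h2
    omega

lemma row_gt (D : Finset (ℕ × ℕ)) (hD : IsStandardSet D) (a b : ℕ) (h : (a, b) ∈ D) :
    a < (D.filter (fun p => p.2 = b)).card := by
  have : ((Finset.range (a + 1)).image (fun x => (x, b))) ⊆ D.filter (fun p => p.2 = b) := by
    intro p hp
    simp only [Finset.mem_image, Finset.mem_range] at hp
    obtain ⟨x, hx, rfl⟩ := hp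
    simp only [Finset.mem_filter, and_true]
    exact hD _ h _ (by simp; omega) (by simp)
  have h2 := Finset.card_le_card this
  rw [Finset.card_image_of_injective _ (fun x y hxy => by simpa using hxy),
    Finset.card_range] at h2
  omega

lemma row_le (D : Finset (ℕ × ℕ)) (hD : IsStandardSet D) (a b : ℕ) (h : (a, b) ∉ D) :
    (D.filter (fun p => p.2 = b)).card ≤ a := by
  have : D.filter (fun p => p.2 = b) ⊆ ((Finset.range a).image (fun x => (x, b))) := by
    rintro ⟨x, y⟩ hp
    simp only [Finset.mem_filter] at hp
    obtain ⟨hp, rfl⟩ := hp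
    simp only [Finset.mem_image, Finset.mem_range]
    refine ⟨x, ?_, rfl⟩
    by_contra hx
    exact h (hD _ hp _ (by simp; omega) (by simp))
  have h2 := Finset.card_le_card this
  have h3 := Finset.card_image_le (s := Finset.range a) (f := fun x => (x, b))
  rw [Finset.card_range] at h3
  omega

/-- For `λ = (λ₁, λ₂)` with `λ₁ < 0 < λ₂`, the ordering `≤_λ` strictly refines the
dominance order on standard sets of a fixed cardinality. -/
theorem lambda_refines_dominance (l : ℤ × ℤ) (hl1 : l.1 < 0) (hl2 : 0 < l.2)
    (m : ℕ) (Δ Δ' : Finset (ℕ × ℕ)) (hΔ : IsStandardSet Δ) (hΔ' : IsStandardSet Δ')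
    (hcard : Δ.card = m) (hcard' : Δ'.card = m)
    (hdom : DomLE Δ Δ') (hne : Δ ≠ Δ') :
    setWeight l Δ' < setWeight l Δ := by
  obtain ⟨hr, hc⟩ := hdom
  obtain ⟨⟨a, b⟩, hp, hp'⟩ : ∃ p ∈ Δ, p ∉ Δ' := by
    by_contra! hsub
    exact hne (Finset.eq_of_subset_of_card_le hsub (by omega))
  obtain ⟨k, hk⟩ : ∃ k, (Δ.filter (fun p => p.2 < k + 1)).card <
      (Δ'.filter (fun p => p.2 < k + 1)).card := by
    have h1 := row_gt Δ hΔ a b hp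
    have h2 := row_le Δ' hΔ' a b hp'
    have h3 := row_split Δ b
    have h4 := row_split Δ' b
    have h5 := hr (b + 1)
    rcases b with _ | b
    · simp at h3 h4 h5 h1 h2
      omega
    · exact ⟨b, by omega⟩
  let N := (Δ ∪ Δ').sup (fun p => p.1 + p.2) + k + 1
  have hN : ∀ p ∈ Δ ∪ Δ', p.1 + p.2 ≤ N := fun p hp => by
    have := Finset.le_sup (f := fun p : ℕ × ℕ => p.1 + p.2) hp
    simp only [N]
    omega
  have e1 := sum_add_counts Prod.fst N Δ
    (fun p hp => by have := hN p (Finset.mem_union_left _ hp); omega)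
  have e2 := sum_add_counts Prod.snd N Δ
    (fun p hp => by have := hN p (Finset.mem_union_left _ hp); omega)
  have e1' := sum_add_counts Prod.fst N Δ'
    (fun p hp => by have := hN p (Finset.mem_union_right _ hp); omega)
  have e2' := sum_add_counts Prod.snd N Δ'
    (fun p hp => by have := hN p (Finset.mem_union_right _ hp); omega)
  rw [hcard] at e1 e2
  rw [hcard'] at e1' e2'
  have s1 := Finset.sum_le_sum (s := Finset.range N) (fun i _ => hc (i + 1))
  have s2 := Finset.sum_lt_sum (s := Finset.range N) (fun i _ => hr (i + 1))
    ⟨k, by simp only [Finset.mem_range, N]; omega, hk⟩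
  have t1 : ((∑ p ∈ Δ, p.1 : ℕ) : ℤ) ≤ (∑ p ∈ Δ', p.1 : ℕ) := by
    exact_mod_cast (by omega : ∑ p ∈ Δ, p.1 ≤ ∑ p ∈ Δ', p.1)
  have t2 : ((∑ p ∈ Δ', p.2 : ℕ) : ℤ) < (∑ p ∈ Δ, p.2 : ℕ) := by
    exact_mod_cast (by omega : ∑ p ∈ Δ', p.2 < ∑ p ∈ Δ, p.2)
  push_cast at t1 t2
  unfold setWeight
  rw [Finset.sum_add_distrib, Finset.sum_add_distrib, ← Finset.mul_sum, ← Finset.mul_sum,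
    ← Finset.mul_sum, ← Finset.mul_sum]
  have u1 := mul_le_mul_of_nonpos_left t1 hl1.le
  have u2 := mul_lt_mul_of_pos_left t2 hl2
  linarith
end

section
/- Let m ∈ ℕ and let μ = (μ₁,μ₂) ∈ ℤ² with μ₂ < 0 and μ₁ < m²·μ₂. If Δ, Δ' are standard sets of cardinality m with Δ ≤ Δ' in the dominance order and Δ ≠ Δ', then ⟨μ,Δ⟩ > ⟨μ,Δ'⟩, i.e. Δ <_μ Δ'. Thus ≤_μ strictly refines the dominance order on standard sets of cardinality m. -/
theorem std_mem_iff (D : Finset (ℕ × ℕ)) (h : IsStandardSet D) (a b : ℕ) :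
    (a, b) ∈ D ↔ b < (D.filter (fun p => p.1 = a)).card := by
  constructor
  · intro hm
    have hs : (Finset.range (b+1)).image (fun t => (a, t)) ⊆ D.filter (fun p => p.1 = a) := by
      intro q hq
      simp only [Finset.mem_image, Finset.mem_range] at hq
      obtain ⟨t, ht, rfl⟩ := hq
      simp only [Finset.mem_filter, and_true]
      exact h _ hm _ le_rfl (by simp; omega)
    have hc := Finset.card_le_card hs
    rw [Finset.card_image_of_injective _ (fun x y hxy => by simpa using hxy),
      Finset.card_range] at hc
    omega
  · intro hlt
    by_contra hm
    have hs : D.filter (fun p => p.1 = a) ⊆ (Finset.range b).image (fun t => (a, t)) := by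
      rintro ⟨x, y⟩ hq
      simp only [Finset.mem_filter] at hq
      obtain ⟨hq, rfl⟩ := hq
      simp only [Finset.mem_image, Finset.mem_range]
      refine ⟨y, ?_, rfl⟩
      by_contra hy
      exact hm (h _ hq _ le_rfl (by simp; omega))
    have hc := (Finset.card_le_card hs).trans Finset.card_image_le
    rw [Finset.card_range] at hc
    omega

theorem std_snd_lt (D : Finset (ℕ × ℕ)) (h : IsStandardSet D) (p : ℕ × ℕ) (hp : p ∈ D) :
    p.2 < D.card :=
  lt_of_lt_of_le ((std_mem_iff D h p.1 p.2).1 hp) (Finset.card_le_card (Finset.filter_subset _ _))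

theorem std_fst_lt (D : Finset (ℕ × ℕ)) (h : IsStandardSet D) (p : ℕ × ℕ) (hp : p ∈ D) :
    p.1 < D.card := by
  have hs : (Finset.range (p.1+1)).image (fun t => (t, p.2)) ⊆ D := by
    intro q hq
    simp only [Finset.mem_image, Finset.mem_range] at hq
    obtain ⟨t, ht, rfl⟩ := hq
    exact h _ hp _ (by simp; omega) le_rfl
  have hc := Finset.card_le_card hs
  rw [Finset.card_image_of_injective _ (fun x y hxy => by simpa using hxy),
    Finset.card_range] at hc
  omega

theorem std_sum_fst (D : Finset (ℕ × ℕ)) (h : IsStandardSet D) :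
    ∑ p ∈ D, p.1 + ∑ j ∈ Finset.range D.card, (D.filter (fun p => p.1 < j + 1)).card
      = D.card * D.card := by
  have h1 : ∑ j ∈ Finset.range D.card, (D.filter (fun p => p.1 < j + 1)).card
      = ∑ p ∈ D, ((Finset.range D.card).filter (fun j => p.1 < j + 1)).card := by
    simp only [Finset.card_filter]
    exact Finset.sum_comm
  rw [h1, ← Finset.sum_add_distrib]
  rw [Finset.sum_const_nat (m := D.card)]
  intro p hp
  have hlt := std_fst_lt D h p hp
  have : (Finset.range D.card).filter (fun j => p.1 < j + 1) = Finset.Ico p.1 D.card := by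
    ext j
    simp only [Finset.mem_filter, Finset.mem_range, Finset.mem_Ico]
    omega
  rw [this, Nat.card_Ico]
  omega

theorem col_card (D : Finset (ℕ × ℕ)) (a : ℕ) :
    (D.filter (fun p => p.1 < a + 1)).card
      = (D.filter (fun p => p.1 < a)).card + (D.filter (fun p => p.1 = a)).card := by
  rw [← Finset.card_union_of_disjoint]
  · congr 1
    ext p
    simp only [Finset.mem_filter, Finset.mem_union]
    grind
  · rw [Finset.disjoint_filter]
    intro p _ h1 h2
    omega

/-- For `μ = (μ₁, μ₂)` with `μ₁ ≪ μ₂ < 0` (precisely `μ₁ < m²·μ₂`), the ordering `≤_μ`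
strictly refines the dominance order on standard sets of cardinality `m`. -/
theorem mu_refines_dominance (m : ℕ) (μ : ℤ × ℤ) (hμ2 : μ.2 < 0)
    (hμ1 : μ.1 < (m : ℤ)^2 * μ.2)
    (Δ Δ' : Finset (ℕ × ℕ)) (hΔ : IsStandardSet Δ) (hΔ' : IsStandardSet Δ')
    (hcard : Δ.card = m) (hcard' : Δ'.card = m)
    (hdom : DomLE Δ Δ') (hne : Δ ≠ Δ') :
    setWeight μ Δ' < setWeight μ Δ := by
  obtain ⟨-, hcol⟩ := hdom
  have e := std_sum_fst Δ hΔ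
  have e' := std_sum_fst Δ' hΔ'
  rw [hcard] at e
  rw [hcard'] at e'
  have hX : ∑ p ∈ Δ, p.1 < ∑ p ∈ Δ', p.1 := by
    by_contra hcon
    have hle : ∀ j ∈ Finset.range m, (Δ'.filter (fun p => p.1 < j + 1)).card
        ≤ (Δ.filter (fun p => p.1 < j + 1)).card := fun j _ => hcol (j+1)
    have hs := Finset.sum_le_sum hle
    have heq := (Finset.sum_eq_sum_iff_of_le hle).1 (by omega)
    have hall : ∀ j, (Δ'.filter (fun p => p.1 < j)).card
        = (Δ.filter (fun p => p.1 < j)).card := by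
      intro j
      rcases j with _ | j
      · simp
      · by_cases hj : j < m
        · exact heq j (Finset.mem_range.2 hj)
        · rw [Finset.filter_true_of_mem, Finset.filter_true_of_mem, hcard, hcard']
          · intro p hp
            have := std_fst_lt Δ hΔ p hp
            omega
          · intro p hp
            have := std_fst_lt Δ' hΔ' p hp
            omega
    apply hne
    ext ⟨a, b⟩
    rw [std_mem_iff Δ hΔ, std_mem_iff Δ' hΔ']
    have h1 := col_card Δ a
    have h2 := col_card Δ' a
    have h3 := hall a
    have h4 := hall (a+1)
    omega
  have hY : ∑ p ∈ Δ, p.2 ≤ m * m := by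
    have := Finset.sum_le_card_nsmul Δ (fun p => p.2) m
      (fun p hp => by have := std_snd_lt Δ hΔ p hp; omega)
    simpa [hcard] using this
  have hw : ∀ D : Finset (ℕ × ℕ), setWeight μ D
      = μ.1 * ((∑ p ∈ D, p.1 : ℕ) : ℤ) + μ.2 * ((∑ p ∈ D, p.2 : ℕ) : ℤ) := by
    intro D
    unfold setWeight
    push_cast
    rw [Finset.sum_add_distrib, Finset.mul_sum, Finset.mul_sum]
  rw [hw, hw]
  generalize ∑ p ∈ Δ, p.1 = X at *
  generalize ∑ p ∈ Δ', p.1 = X' at *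
  generalize ∑ p ∈ Δ, p.2 = Y at *
  generalize ∑ p ∈ Δ', p.2 = Y' at *
  have hX2 : (X : ℤ) + 1 ≤ X' := by exact_mod_cast hX
  have hY2 : (Y : ℤ) ≤ m * m := by exact_mod_cast hY
  have hY3 : (0 : ℤ) ≤ Y' := by positivity
  have hneg : μ.1 < 0 := by nlinarith [sq_nonneg (m : ℤ)]
  nlinarith [mul_nonneg (sub_nonneg.2 hX2) (neg_nonneg.2 hneg.le),
    mul_nonneg (sub_nonneg.2 hY2) (neg_nonneg.2 hμ2.le), mul_nonneg hY3 (neg_nonneg.2 hμ2.le)]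
end

section
/- Let m ∈ ℕ and let ν = (ν₁,ν₂) ∈ ℤ² with 0 < ν₁ and m²·ν₁ < ν₂. If Δ, Δ' are standard sets of cardinality m with Δ ≤ Δ' in the dominance order and Δ ≠ Δ', then ⟨ν,Δ⟩ > ⟨ν,Δ'⟩, i.e. Δ <_ν Δ'. Thus ≤_ν strictly refines the dominance order on standard sets of cardinality m. -/
lemma aux_bound1 (Δ : Finset (ℕ × ℕ)) (h : IsStandardSet Δ) (p : ℕ × ℕ) (hp : p ∈ Δ) :
    p.1 < Δ.card := by
  have hs : (Finset.range (p.1 + 1)).image (fun a => (a, p.2)) ⊆ Δ := by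
    intro q hq
    simp only [Finset.mem_image, Finset.mem_range] at hq
    obtain ⟨a, ha, rfl⟩ := hq
    exact h p hp _ (by simp; omega) (by simp)
  have := Finset.card_le_card hs
  rw [Finset.card_image_of_injective _ (fun a b hab => by simpa using hab),
    Finset.card_range] at this
  omega

lemma aux_bound2 (Δ : Finset (ℕ × ℕ)) (h : IsStandardSet Δ) (p : ℕ × ℕ) (hp : p ∈ Δ) :
    p.2 < Δ.card := by
  have hs : (Finset.range (p.2 + 1)).image (fun a => (p.1, a)) ⊆ Δ := by
    intro q hq
    simp only [Finset.mem_image, Finset.mem_range] at hq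
    obtain ⟨a, ha, rfl⟩ := hq
    exact h p hp _ (by simp) (by simp; omega)
  have := Finset.card_le_card hs
  rw [Finset.card_image_of_injective _ (fun a b hab => by simpa using hab),
    Finset.card_range] at this
  omega

lemma aux_pt (N b : ℕ) (h : b ≤ N) :
    b + ∑ i ∈ Finset.range N, (if b < i + 1 then 1 else 0) = N := by
  induction N, h using Nat.le_induction with
  | base =>
    rw [Finset.sum_eq_zero]
    · rfl
    · intro i hi
      rw [Finset.mem_range] at hi
      rw [if_neg (by omega)]
  | succ n hn ih =>
    rw [Finset.sum_range_succ, if_pos (by omega)]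
    omega

lemma aux_sum (Δ : Finset (ℕ × ℕ)) (N : ℕ) (h : ∀ p ∈ Δ, p.2 ≤ N) :
    ∑ p ∈ Δ, p.2 + ∑ i ∈ Finset.range N, (Δ.filter (fun p => p.2 < i + 1)).card
      = Δ.card * N := by
  simp only [Finset.card_filter]
  rw [Finset.sum_comm, ← Finset.sum_add_distrib, Finset.sum_congr rfl
    (fun p hp => aux_pt N p.2 (h p hp))]
  simp

lemma aux_row (Δ : Finset (ℕ × ℕ)) (b : ℕ) :
    (Δ.filter (fun p => p.2 < b + 1)).card =
      (Δ.filter (fun p => p.2 < b)).card + (Δ.filter (fun p => p.2 = b)).card := by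
  rw [← Finset.card_union_of_disjoint]
  · congr 1
    ext q
    simp only [Finset.mem_filter, Finset.mem_union]
    grind
  · rw [Finset.disjoint_left]
    intro q
    simp only [Finset.mem_filter]
    grind

theorem nu_refines_dominance (m : ℕ) (ν : ℤ × ℤ) (hν1 : 0 < ν.1)
    (hν2 : (m : ℤ)^2 * ν.1 < ν.2)
    (Δ Δ' : Finset (ℕ × ℕ)) (hΔ : IsStandardSet Δ) (hΔ' : IsStandardSet Δ')
    (hcard : Δ.card = m) (hcard' : Δ'.card = m)
    (hdom : DomLE Δ Δ') (hne : Δ ≠ Δ') :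
    setWeight ν Δ' < setWeight ν Δ := by
  obtain ⟨p, hp, hp'⟩ : ∃ p ∈ Δ, p ∉ Δ' := by
    by_contra! hcon
    exact hne (Finset.eq_of_subset_of_card_le hcon (by omega))
  have hrow : (Δ'.filter (fun q => q.2 = p.2)).card < (Δ.filter (fun q => q.2 = p.2)).card := by
    apply Finset.card_lt_card
    rw [Finset.ssubset_iff_of_subset]
    · exact ⟨p, by simp [hp], by simp [hp']⟩
    · intro q hq
      simp only [Finset.mem_filter] at hq ⊢
      refine ⟨hΔ p hp q ?_ hq.2.le, hq.2⟩
      by_contra! hlt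
      exact hp' (hΔ' q hq.1 p hlt.le hq.2.ge)
  have hpm : p.2 < m := hcard ▸ aux_bound2 Δ hΔ p hp
  have r := aux_row Δ p.2
  have r' := aux_row Δ' p.2
  have hlt : ∑ i ∈ Finset.range m, (Δ.filter (fun p => p.2 < i + 1)).card <
      ∑ i ∈ Finset.range m, (Δ'.filter (fun p => p.2 < i + 1)).card := by
    apply Finset.sum_lt_sum (fun i _ => hdom.1 (i + 1))
    by_contra! hcon
    have h1 := hcon p.2 (by simpa using hpm)
    have h2 := hdom.1 p.2
    have h4 := hdom.1 (p.2 + 1)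
    have h3 : (Δ'.filter (fun q => q.2 < p.2)).card ≤ (Δ.filter (fun q => q.2 < p.2)).card := by
      rcases Nat.eq_zero_or_pos p.2 with h0 | h0
      · simp [h0]
      · have := hcon (p.2 - 1) (by simp; omega)
        rwa [Nat.sub_add_cancel h0] at this
    omega
  have s := aux_sum Δ m (fun q hq => hcard ▸ (aux_bound2 Δ hΔ q hq).le)
  have s' := aux_sum Δ' m (fun q hq => hcard' ▸ (aux_bound2 Δ' hΔ' q hq).le)
  rw [hcard] at s
  rw [hcard'] at s'
  have hb : ∑ p ∈ Δ', p.2 + 1 ≤ ∑ p ∈ Δ, p.2 := by omega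
  have ha : ∑ p ∈ Δ', p.1 ≤ m * m := by
    have := Finset.sum_le_card_nsmul Δ' (fun p => p.1) m
      (fun q hq => hcard' ▸ (aux_bound1 Δ' hΔ' q hq).le)
    simpa [hcard'] using this
  have w : ∀ D : Finset (ℕ × ℕ), setWeight ν D =
      ν.1 * ((∑ p ∈ D, p.1 : ℕ) : ℤ) + ν.2 * ((∑ p ∈ D, p.2 : ℕ) : ℤ) := by
    intro D
    simp [setWeight, Finset.sum_add_distrib, Finset.mul_sum]
  rw [w, w]
  generalize ∑ p ∈ Δ', p.1 = A' at *
  generalize ∑ p ∈ Δ', p.2 = B' at *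
  generalize ∑ p ∈ Δ, p.1 = A at *
  generalize ∑ p ∈ Δ, p.2 = B at *
  have ha' : (A' : ℤ) ≤ m * m := by exact_mod_cast ha
  have hb' : (B' : ℤ) + 1 ≤ B := by exact_mod_cast hb
  have hν2p : 0 < ν.2 := lt_of_le_of_lt (by positivity) hν2
  have e1 := mul_le_mul_of_nonneg_left ha' hν1.le
  have e2 := mul_le_mul_of_nonneg_left hb' hν2p.le
  have e3 : 0 ≤ ν.1 * (A : ℤ) := by positivity
  nlinarith
end

section
/- Let n ∈ ℕ and let (Δ₂, Δ₁, Δ₀) be a triple of standard sets with |Δ₂| + |Δ₁| + |Δ₀| = n. Define ι(Δ₂, Δ₁, Δ₀) := (Δ₀ᵗ, Δ₁ᵗ, Δ₂ᵗ). Then: (1) ι(Δ₂, Δ₁, Δ₀) is again a triple of standard sets whose cardinalities sum to n; (2) ι is an involution, ι(ι(Δ₂, Δ₁, Δ₀)) = (Δ₂, Δ₁, Δ₀); (3) if |Δ₂| + h(Δ₂) + |Δ₁| + |Δ₀| − w(Δ₀) = k, then the corresponding statistic of ι(Δ₂, Δ₁, Δ₀), namely |Δ₀ᵗ| + h(Δ₀ᵗ)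 + |Δ₁ᵗ| + |Δ₂ᵗ| − w(Δ₂ᵗ), equals 2n − k. (Thus ι maps the set T^k of triples with statistic k bijectively onto T^{2n−k}.) -/
/-- The transpose of a finite subset of `ℕ²`. -/
def transposeSet (Δ : Finset (ℕ × ℕ)) : Finset (ℕ × ℕ) :=
  Δ.image (fun p => (p.2, p.1))

/-- The height of a standard set: the number of its rows. -/
def height (Δ : Finset (ℕ × ℕ)) : ℕ := (Δ.filter (fun p => p.1 = 0)).card

/-- The width of a standard set: the number of its columns. -/
def width (Δ : Finset (ℕ × ℕ)) : ℕ := (Δ.filter (fun p => p.2 = 0)).card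

theorem mem_tr (Δ : Finset (ℕ × ℕ)) (a b : ℕ) : (a, b) ∈ transposeSet Δ ↔ (b, a) ∈ Δ := by
  simp [transposeSet]

theorem std_tr (Δ : Finset (ℕ × ℕ)) (h : IsStandardSet Δ) : IsStandardSet (transposeSet Δ) := by
  rintro ⟨a, b⟩ hp ⟨c, d⟩ h1 h2
  rw [mem_tr] at hp ⊢
  exact h _ hp _ h2 h1

theorem inj_tr : Function.Injective (fun p : ℕ × ℕ => (p.2, p.1)) := by
  rintro ⟨a, b⟩ ⟨c, d⟩ h
  simp at h
  simp [h]

theorem card_tr (Δ : Finset (ℕ × ℕ)) : (transposeSet Δ).card = Δ.card :=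
  Finset.card_image_of_injective _ inj_tr

theorem tr_tr (Δ : Finset (ℕ × ℕ)) : transposeSet (transposeSet Δ) = Δ := by
  ext ⟨a, b⟩
  rw [mem_tr, mem_tr]

theorem height_tr (Δ : Finset (ℕ × ℕ)) : height (transposeSet Δ) = width Δ := by
  unfold height width
  rw [← card_tr (Δ.filter (fun p => p.2 = 0))]
  congr 1
  ext ⟨a, b⟩
  simp [mem_tr]

theorem width_tr (Δ : Finset (ℕ × ℕ)) : width (transposeSet Δ) = height Δ := by
  rw [← height_tr, tr_tr]

/-- The involution `ι(Δ₂,Δ₁,Δ₀) = (Δ₀ᵗ,Δ₁ᵗ,Δ₂ᵗ)` preserves triples of standard sets with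
cardinalities summing to `n`, is an involution, and sends the dimension statistic `k`
to `2n - k`. -/
theorem iota_involution (n : ℕ) (Δ₂ Δ₁ Δ₀ : Finset (ℕ × ℕ))
    (h₂ : IsStandardSet Δ₂) (h₁ : IsStandardSet Δ₁) (h₀ : IsStandardSet Δ₀)
    (hsum : Δ₂.card + Δ₁.card + Δ₀.card = n) :
    (IsStandardSet (transposeSet Δ₀) ∧ IsStandardSet (transposeSet Δ₁) ∧
      IsStandardSet (transposeSet Δ₂) ∧
      (transposeSet Δ₀).card + (transposeSet Δ₁).card + (transposeSet Δ₂).card = n) ∧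
    (transposeSet (transposeSet Δ₂) = Δ₂ ∧ transposeSet (transposeSet Δ₁) = Δ₁ ∧
      transposeSet (transposeSet Δ₀) = Δ₀) ∧
    (∀ k : ℤ,
      (Δ₂.card : ℤ) + height Δ₂ + Δ₁.card + Δ₀.card - width Δ₀ = k →
      ((transposeSet Δ₀).card : ℤ) + height (transposeSet Δ₀) + (transposeSet Δ₁).card
        + (transposeSet Δ₂).card - width (transposeSet Δ₂) = 2 * n - k) := by
  refine ⟨⟨std_tr _ h₀, std_tr _ h₁, std_tr _ h₂, ?_⟩, ⟨tr_tr _, tr_tr _, tr_tr _⟩, ?_⟩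
  · simp only [card_tr]
    omega
  · intro k hk
    simp only [card_tr, height_tr, width_tr]
    omega
end
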